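/- There exists an absolute constant c > 0 with the following property. For every positive integer k, the number of distinct functions of the form h_{G,k}, taken over all finite simple graphs G whose vertex set contains {1,…,k}, is at most 2^{c·k³}. -/

import Mathlib

/-- A graph has a perfect matching if some subgraph of it is a perfect matching. -/
def HasPerfectMatching {V : Type} (G : SimpleGraph V) : Prop :=
  ∃ M : G.Subgraph, M.IsPerfectMatching

section

open Matrix

/-- The matrix that agrees with `A` on `s × s` and with the identity matrix elsewhere, so that its
determinant is the principal minor of `A` on `s`. -/
def Matrix.padPrincipal {V R : Type*} [DecidableEq V] [Zero R] [One R]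
    (A : Matrix V V R) (s : Finset V) : Matrix V V R :=
  Matrix.of fun i j => if i ∈ s ∧ j ∈ s then A i j else if i = j then 1 else 0

theorem Matrix.padPrincipal_mulVec_of_notMem {V R : Type*} [Fintype V] [DecidableEq V] [CommRing R]
    (A : Matrix V V R) {s : Finset V} {i : V} (hi : i ∉ s) (v : V → R) :
    (A.padPrincipal s *ᵥ v) i = v i := by
  simp [padPrincipal, mulVec, dotProduct, hi]

theorem Matrix.padPrincipal_mulVec_of_mem {V R : Type*} [Fintype V] [DecidableEq V] [CommRing R]
    (A : Matrix V V R) {s : Finset V} {i : V} (hi : i ∈ s) {v : V → R} (hv : ∀ j ∉ s, v j = 0) :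
    (A.padPrincipal s *ᵥ v) i = (A *ᵥ v) i := by
  refine Finset.sum_congr rfl fun j _ => ?_
  by_cases hj : j ∈ s
  · simp [padPrincipal, hi, hj]
  · simp [hv j hj]

theorem Matrix.det_padPrincipal_ne_zero_iff {V F : Type*} [Fintype V] [DecidableEq V] [Field F]
    (A : Matrix V V F) (s : Finset V) :
    (A.padPrincipal s).det ≠ 0 ↔
      ∀ v : V → F, (∀ i ∉ s, v i = 0) → (∀ i ∈ s, (A *ᵥ v) i = 0) → v = 0 := by
  rw [ne_eq, ← exists_mulVec_eq_zero_iff]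
  push Not
  constructor
  · intro h v hv hA
    by_contra hne
    refine h v hne (funext fun i => ?_)
    by_cases hi : i ∈ s
    · rw [padPrincipal_mulVec_of_mem A hi hv, hA i hi, Pi.zero_apply]
    · rw [padPrincipal_mulVec_of_notMem A hi, hv i hi, Pi.zero_apply]
  · intro h v hne hA
    have hv : ∀ i ∉ s, v i = 0 := fun i hi => by
      rw [← padPrincipal_mulVec_of_notMem A hi v, hA, Pi.zero_apply]
    refine hne (h v hv fun i hi => ?_)
    rw [← padPrincipal_mulVec_of_mem A hi hv, hA, Pi.zero_apply]

/-- `m` matches the vertices of `s` among themselves along edges of `G`. -/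
def SimpleGraph.IsMatchingOn {V : Type*} (G : SimpleGraph V) (s : Finset V) (m : V → V) : Prop :=
  ∀ i ∈ s, m i ∈ s ∧ G.Adj i (m i) ∧ m (m i) = i

theorem Matrix.dotProduct_mulVec_of_skew {V F : Type*} [Fintype V] [CommRing F]
    {A : Matrix V V F} (hA : Aᵀ = -A) (u v : V → F) : u ⬝ᵥ A *ᵥ v = -(v ⬝ᵥ A *ᵥ u) := by
  rw [dotProduct_mulVec, ← mulVec_transpose, hA, neg_mulVec, neg_dotProduct, dotProduct_comm]

theorem SimpleGraph.exists_isMatchingOn_of_det_ne_zero {V F : Type*} [Fintype V] [DecidableEq V]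
    [Field F] [CharZero F] (G : SimpleGraph V) {A : Matrix V V F} (hA : Aᵀ = -A)
    (hG : ∀ i j, A i j ≠ 0 → G.Adj i j) (s : Finset V) (hs : (A.padPrincipal s).det ≠ 0) :
    ∃ m, G.IsMatchingOn s m := by
  induction s using Finset.strongInduction with
  | H s ih =>
  obtain rfl | ⟨i, hi⟩ := s.eq_empty_or_nonempty
  · exact ⟨id, by simp [IsMatchingOn]⟩
  obtain ⟨w, hw⟩ : ∃ w, A.padPrincipal s *ᵥ w = Pi.single i 1 :=
    ⟨(A.padPrincipal s)⁻¹ *ᵥ Pi.single i 1, by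
      rw [mulVec_mulVec, mul_nonsing_inv _ (isUnit_iff_ne_zero.2 hs), one_mulVec]⟩
  have hw0 : ∀ j ∉ s, w j = 0 := fun j hj => by
    rw [← padPrincipal_mulVec_of_notMem A hj w, hw, Pi.single_eq_of_ne]
    rintro rfl
    exact hj hi
  have hw1 : ∀ j ∈ s, (A *ᵥ w) j = Pi.single (M := fun _ => F) i 1 j := fun j hj => by
    rw [← hw, padPrincipal_mulVec_of_mem A hj hw0]
  have hdot : ∀ u : V → F, (∀ j ∉ s, u j = 0) → u ⬝ᵥ A *ᵥ w = u i := fun u hu => by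
    rw [← dotProduct_single_one u i]
    refine Finset.sum_congr rfl fun j _ => ?_
    by_cases hj : j ∈ s
    · rw [hw1 j hj]
    · simp [hu j hj]
  have hwi : w i = 0 := by
    have := dotProduct_mulVec_of_skew hA w w
    rw [hdot w hw0] at this
    exact self_eq_neg.1 this
  obtain ⟨l, hl⟩ : ∃ l, A i l * w l ≠ 0 := by
    by_contra! h
    have := hw1 i hi
    rw [Pi.single_eq_same] at this
    exact zero_ne_one ((Finset.sum_eq_zero fun l _ => h l).symm.trans this)
  have hAl := left_ne_zero_of_mul hl
  have hwl := right_ne_zero_of_mul hl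
  have hls : l ∈ s := by
    by_contra h
    exact hwl (hw0 l h)
  have hil : i ≠ l := by
    rintro rfl
    exact hwl hwi
  obtain ⟨m, hm⟩ := ih ((s.erase i).erase l)
    ((Finset.erase_subset _ _).trans_ssubset (Finset.erase_ssubset hi)) <| by
    rw [det_padPrincipal_ne_zero_iff]
    intro u hu hAu
    have hui : u i = 0 := hu i (by simp)
    have hul : u l = 0 := hu l (by simp)
    have hus : ∀ j ∉ s, u j = 0 := fun j hj => hu j (by simp [hj])
    have hAul : (A *ᵥ u) l = 0 := by
      have h1 : w ⬝ᵥ A *ᵥ u = w l * (A *ᵥ u) l := by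
        refine Finset.sum_eq_single l (fun j _ hj => ?_) (by simp)
        by_cases hjs : j ∈ s
        · obtain rfl | hji := eq_or_ne j i
          · simp [hwi]
          · simp [hAu j (by simp [hj, hji, hjs])]
        · simp [hw0 j hjs]
      have h2 := dotProduct_mulVec_of_skew hA u w
      rw [hdot u hus, hui, h1, zero_eq_neg] at h2
      exact (mul_eq_zero.1 h2).resolve_left hwl
    have h3 : u - (A *ᵥ u) i • w = 0 := by
      refine (det_padPrincipal_ne_zero_iff A s).1 hs _ (fun j hj => by simp [hus j hj, hw0 j hj])
        fun j hj => ?_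
      rw [mulVec_sub, mulVec_smul, Pi.sub_apply, Pi.smul_apply, hw1 j hj]
      obtain rfl | hji := eq_or_ne j i
      · simp
      · obtain rfl | hjl := eq_or_ne j l
        · simp [hAul, hji]
        · simp [hji, hAu j (by simp [hjl, hji, hj])]
    have h4 : (A *ᵥ u) i = 0 := by
      have := congrFun h3 l
      simpa [hul, hwl] using this
    simpa [h4] using h3
  refine ⟨fun j => if j = i then l else if j = l then i else m j, fun j hj => ?_⟩
  obtain rfl | hji := eq_or_ne j i
  · simp [hls, hG _ _ hAl, hil.symm]
  obtain rfl | hjl := eq_or_ne j l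
  · simp [hi, hil.symm, (hG _ _ hAl).symm]
  have := hm j (by simp [hji, hjl, hj])
  simp only [Finset.mem_erase] at this
  simp_all

/-- The skew-symmetric matrix with entries `x (i, j) - x (j, i)` on the edges of `G`. -/
def SimpleGraph.skewAdjMatrix {V R : Type*} (G : SimpleGraph V) [DecidableRel G.Adj] [Zero R]
    [Sub R] (x : V × V → R) : Matrix V V R :=
  Matrix.of fun i j => if G.Adj i j then x (i, j) - x (j, i) else 0

theorem SimpleGraph.transpose_skewAdjMatrix {V R : Type*} (G : SimpleGraph V) [DecidableRel G.Adj]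
    [CommRing R] (x : V × V → R) : (G.skewAdjMatrix x)ᵀ = -G.skewAdjMatrix x := by
  ext i j
  simp only [skewAdjMatrix, transpose_apply, of_apply, Matrix.neg_apply, G.adj_comm j i]
  split_ifs <;> simp

theorem SimpleGraph.exists_skewAdjMatrix_det_ne_zero {V F : Type*} [Fintype V] [DecidableEq V]
    [Field F] [Infinite F] (G : SimpleGraph V) [DecidableRel G.Adj] {s : Finset V} {m : V → V}
    (hm : G.IsMatchingOn s m) :
    ∃ x : V × V → F, ((G.skewAdjMatrix x).padPrincipal s).det ≠ 0 := by
  let e : V ↪ F :=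
    ((Fintype.equivFin V).toEmbedding.trans Fin.valEmbedding).trans (Infinite.natEmbedding F)
  refine ⟨fun p => if p.2 = m p.1 then e p.1 else 0, ?_⟩
  rw [det_padPrincipal_ne_zero_iff]
  intro v hv hA
  funext j
  by_cases hj : j ∈ s
  swap
  · exact hv j hj
  obtain ⟨hmj, hadj, hmm⟩ := hm j hj
  have h := hA (m j) hmj
  rw [mulVec, dotProduct, Finset.sum_eq_single j] at h
  · simp only [skewAdjMatrix, of_apply, hadj.symm, hmm, if_true] at h
    refine (mul_eq_zero.1 h).resolve_left (sub_ne_zero.2 fun h' => hadj.ne (e.injective h').symm)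
  · intro l _ hl
    by_cases hls : l ∈ s
    · have h1 : l ≠ m (m j) := by rwa [hmm]
      have h2 : m j ≠ m l := fun h => hl (by rw [← (hm l hls).2.2, ← h, hmm])
      simp [skewAdjMatrix, h1, h2]
    · simp [hv l hls]
  · simp

theorem SimpleGraph.exists_det_ne_zero_iff_isMatchingOn {V F : Type*} [Fintype V] [DecidableEq V]
    [Field F] [CharZero F] (G : SimpleGraph V) :
    ∃ A : Matrix V V F, ∀ s : Finset V,
      (A.padPrincipal s).det ≠ 0 ↔ ∃ m, G.IsMatchingOn s m := by
  classical
  let P (s : Finset V) : MvPolynomial (V × V) F :=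
    ((G.skewAdjMatrix MvPolynomial.X).padPrincipal s).det
  have hP (x : V × V → F) (s : Finset V) :
      MvPolynomial.eval x (P s) = ((G.skewAdjMatrix x).padPrincipal s).det := by
    rw [RingHom.map_det]
    congr 1
    ext i j
    simp only [RingHom.mapMatrix_apply, map_apply, padPrincipal, skewAdjMatrix, of_apply]
    split_ifs <;> simp
  have hprod : ∏ s with ∃ m, G.IsMatchingOn s m, P s ≠ 0 := by
    refine Finset.prod_ne_zero_iff.2 fun s hs h0 => ?_
    obtain ⟨m, hm⟩ := (Finset.mem_filter.1 hs).2
    obtain ⟨x, hx⟩ := G.exists_skewAdjMatrix_det_ne_zero (F := F) hm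
    rw [← hP, h0, map_zero] at hx
    exact hx rfl
  obtain ⟨x, hx⟩ : ∃ x, MvPolynomial.eval x (∏ s with ∃ m, G.IsMatchingOn s m, P s) ≠ 0 := by
    by_contra! h
    exact hprod (MvPolynomial.funext fun x => by rw [h x, map_zero])
  refine ⟨G.skewAdjMatrix x, fun s =>
    ⟨G.exists_isMatchingOn_of_det_ne_zero (G.transpose_skewAdjMatrix x) (fun i j h => ?_) s,
      fun hm => ?_⟩⟩
  · by_contra hij
    simp [skewAdjMatrix, hij] at h
  · rw [map_prod, Finset.prod_ne_zero_iff] at hx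
    rw [← hP]
    exact hx s (by simpa using hm)

theorem Matrix.exists_det_ite_ne_zero_iff_det_padPrincipal_ne_zero {V K F : Type*} [Fintype V]
    [DecidableEq V] [Fintype K] [DecidableEq K] [Nonempty K] [Field F] (A : Matrix V V F)
    (c : K ↪ V) :
    ∃ X Y : Matrix K K F, ∀ S : Finset K,
      (Matrix.of fun i j => if i ∈ S then X i j else Y i j).det ≠ 0 ↔
        (A.padPrincipal (S.map c)ᶜ).det ≠ 0 := by
  by_cases hS : ∃ S : Finset K, (A.padPrincipal (S.map c)ᶜ).det ≠ 0
  swap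
  · push Not at hS
    refine ⟨0, 0, fun S => ?_⟩
    rw [hS S]
    simp only [zero_apply, ite_self]
    exact iff_of_false (fun h => h det_zero) (fun h => h rfl)
  let T : (V → F) →ₗ[F] ({i // i ∉ Set.range c} → F) :=
    (LinearMap.funLeft F F Subtype.val).comp A.mulVecLin
  have hT (v : V → F) : v ∈ LinearMap.ker T ↔ ∀ i ∉ Set.range c, (A *ᵥ v) i = 0 := by
    simp [T, funext_iff, LinearMap.funLeft_apply]
  let φ (S : Finset K) : LinearMap.ker T →ₗ[F] (K → F) :=
    LinearMap.pi fun i => if i ∈ S then (LinearMap.proj (c i)).comp (LinearMap.ker T).subtype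
      else (LinearMap.proj (c i)).comp (A.mulVecLin.comp (LinearMap.ker T).subtype)
  have hφ (S : Finset K) (v : LinearMap.ker T) (i : K) :
      φ S v i = if i ∈ S then v.1 (c i) else (A *ᵥ v.1) (c i) := by
    simp only [φ, LinearMap.pi_apply]
    split_ifs <;> simp
  have hinj (S : Finset K) :
      (A.padPrincipal (S.map c)ᶜ).det ≠ 0 ↔ Function.Injective (φ S) := by
    rw [det_padPrincipal_ne_zero_iff, injective_iff_map_eq_zero]
    constructor
    · intro h v hv
      ext1
      refine h v.1 (fun i hi => ?_) fun i hi => ?_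
      · obtain ⟨j, hj, rfl⟩ : ∃ j ∈ S, c j = i := by simpa using hi
        simpa [hφ, hj] using congrFun hv j
      · by_cases hic : i ∈ Set.range c
        · obtain ⟨j, rfl⟩ := hic
          have hj : j ∉ S := by simpa using hi
          simpa [hφ, hj] using congrFun hv j
        · exact (hT v.1).1 v.2 i hic
    · intro h v hv hA
      have hvT : v ∈ LinearMap.ker T := (hT v).2 fun i hi => hA i <| by
        simp only [Finset.mem_compl, Finset.mem_map, not_exists, not_and]
        exact fun j _ hj => hi ⟨j, hj⟩
      have := h ⟨v, hvT⟩ (funext fun j => by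
        rw [hφ, Pi.zero_apply]
        split_ifs with hj
        · exact hv _ (by simpa using hj)
        · exact hA _ (by simpa using hj))
      exact congrArg Subtype.val this
  have hdim : Module.finrank F (LinearMap.ker T) = Fintype.card K := by
    apply le_antisymm
    · obtain ⟨S, hS⟩ := hS
      simpa using LinearMap.finrank_le_finrank_of_injective ((hinj S).1 hS)
    · have h1 := LinearMap.finrank_range_add_finrank_ker T
      have h2 := Submodule.finrank_le (LinearMap.range T)
      have h3 : Fintype.card {i // i ∉ Set.range c} = Fintype.card V - Fintype.card K := by
        rw [Fintype.card_subtype_compl]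
        congr 1
        exact Set.card_range_of_injective c.injective
      have h4 := Fintype.card_le_of_embedding c
      simp only [Module.finrank_fintype_fun_eq_card] at h1 h2
      omega
  let e : (K → F) ≃ₗ[F] LinearMap.ker T := LinearEquiv.ofFinrankEq _ _ (by simp [hdim])
  refine ⟨LinearMap.toMatrix' ((φ Finset.univ).comp e.toLinearMap),
    LinearMap.toMatrix' ((φ ∅).comp e.toLinearMap), fun S => ?_⟩
  have hmat : (Matrix.of fun i j =>
      if i ∈ S then LinearMap.toMatrix' ((φ Finset.univ).comp e.toLinearMap) i j
      else LinearMap.toMatrix' ((φ ∅).comp e.toLinearMap) i j) =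
      LinearMap.toMatrix' ((φ S).comp e.toLinearMap) := by
    ext i j
    simp only [of_apply, LinearMap.toMatrix'_apply, LinearMap.comp_apply, hφ]
    simp
  rw [hmat, hinj, ← isUnit_iff_ne_zero, ← isUnit_iff_isUnit_det, ← mulVec_injective_iff_isUnit]
  have : (LinearMap.toMatrix' ((φ S).comp e.toLinearMap)).mulVec = φ S ∘ e := by
    funext v
    rw [LinearMap.toMatrix'_mulVec]
    rfl
  rw [this]
  exact e.toEquiv.injective_comp (φ S)

theorem MvPolynomial.finrank_restrictDegree_le {σ F : Type*} [Fintype σ] [Field F] (N : ℕ) :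
    Module.finrank F (restrictDegree σ F N) ≤ (N + 1) ^ Fintype.card σ := by
  classical
  rw [restrictDegree,
    Module.finrank_eq_nat_card_basis (basisRestrictSupport F {n : σ →₀ ℕ | ∀ i, n i ≤ N})]
  have h := Nat.card_le_card_of_injective
    (fun (n : {n : σ →₀ ℕ | ∀ i, n i ≤ N}) (i : σ) =>
      (⟨n.1 i, Nat.lt_succ_of_le (n.2 i)⟩ : Fin (N + 1))) fun n n' h => by
        ext i
        simpa using congrArg Fin.val (congrFun h i)
  simpa only [Nat.card_eq_fintype_card (α := σ → Fin (N + 1)), Fintype.card_fun,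
    Fintype.card_fin] using h

/-- The number of zero patterns of a finite family of polynomials is at most the dimension of a
space of polynomials containing all products of subfamilies. -/
theorem MvPolynomial.card_zeroPattern_le {σ ι F : Type*} [Fintype σ] [Fintype ι] [Field F]
    (p : ι → MvPolynomial σ F) {d : ℕ} (hp : ∀ i, (p i).totalDegree ≤ d) :
    Nat.card (Set.range fun (x : σ → F) (i : ι) => eval x (p i) ≠ 0) ≤
      (Fintype.card ι * d + 1) ^ Fintype.card σ := by
  classical
  set P := Set.range fun (x : σ → F) (i : ι) => eval x (p i) ≠ 0
  choose x hx using fun h : P => h.2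
  have hx' (h : P) (i : ι) : eval (x h) (p i) ≠ 0 ↔ h.1 i := by rw [← hx h]
  let g (h : P) : MvPolynomial σ F := ∏ i with h.1 i, p i
  have hg (h h' : P) : eval (x h') (g h) ≠ 0 ↔ h.1 ≤ h'.1 := by
    rw [map_prod, Finset.prod_ne_zero_iff]
    simp only [Finset.mem_filter_univ, hx']
    rfl
  have hdeg (h : P) : g h ∈ restrictDegree σ F (Fintype.card ι * d) := by
    refine restrictTotalDegree_le_restrictDegree _ _ _ ((mem_restrictTotalDegree _ _ _).2 ?_)
    refine (totalDegree_finsetProd _ _).trans ?_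
    refine (Finset.sum_le_card_nsmul _ _ d fun i _ => hp i).trans ?_
    exact Nat.mul_le_mul_right _ (Finset.card_le_univ _)
  have hli : LinearIndependent F fun h : P => (⟨g h, hdeg h⟩ : restrictDegree σ F _) := by
    refine LinearIndependent.of_comp (restrictDegree σ F _).subtype ?_
    change LinearIndependent F g
    have : Fintype P := Fintype.ofFinite P
    rw [Fintype.linearIndependent_iff]
    intro a ha
    by_contra! hne
    obtain ⟨h, hmin⟩ := (Set.toFinite {h : P | a h ≠ 0}).exists_minimal hne
    have h0 : ∑ h', a h' * eval (x h) (g h') = 0 := by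
      simpa [smul_eval] using congrArg (eval (x h)) ha
    rw [Finset.sum_eq_single h] at h0
    · exact (mul_ne_zero hmin.1 ((hg h h).2 le_rfl)) h0
    · intro h' _ hh
      by_contra hne'
      have hle : h' ≤ h := (hg h' h).1 (right_ne_zero_of_mul hne')
      exact hh (le_antisymm hle (hmin.2 (left_ne_zero_of_mul hne') hle))
    · simp
  have : Fintype P := Fintype.ofFinite P
  rw [Nat.card_eq_fintype_card]
  exact hli.fintype_card_le_finrank.trans (finrank_restrictDegree_le _)

theorem MvPolynomial.totalDegree_det_le {σ K R : Type*} [Fintype K] [DecidableEq K] [CommRing R]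
    (M : Matrix K K (MvPolynomial σ R)) (hM : ∀ i j, (M i j).totalDegree ≤ 1) :
    M.det.totalDegree ≤ Fintype.card K := by
  rw [det_apply]
  refine totalDegree_finsetSum_le fun τ _ => ?_
  refine (totalDegree_smul_le _ _).trans ((totalDegree_finsetProd _ _).trans ?_)
  exact (Finset.sum_le_card_nsmul _ _ 1 fun i _ => hM _ _).trans (by simp)

theorem hasPerfectMatching_induce_iff {V : Type} (G : SimpleGraph V) (s : Finset V) :
    HasPerfectMatching (G.induce (s : Set V)) ↔ ∃ m, G.IsMatchingOn s m := by
  classical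
  constructor
  · rintro ⟨M, hM⟩
    rw [SimpleGraph.Subgraph.isPerfectMatching_iff] at hM
    choose f hf hf' using hM
    refine ⟨fun v => if h : v ∈ s then (f ⟨v, h⟩).1 else v, fun v hv => ?_⟩
    have hff : f (f ⟨v, hv⟩) = ⟨v, hv⟩ := (hf' _ _ (hf ⟨v, hv⟩).symm).symm
    have hmem : (f ⟨v, hv⟩).1 ∈ s := (f ⟨v, hv⟩).2
    simp only [hv, dif_pos, hmem, true_and]
    exact ⟨M.adj_sub (hf ⟨v, hv⟩), congrArg Subtype.val hff⟩
  · rintro ⟨m, hm⟩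
    refine ⟨{ verts := Set.univ
              Adj := fun a b => m a = b
              adj_sub := ?_
              edge_vert := fun _ => Set.mem_univ _
              symm := ⟨?_⟩ }, ?_⟩
    · intro a b h
      have := (hm a.1 a.2).2.1
      rwa [h] at this
    · intro a b h
      rw [← h]
      exact (hm a.1 a.2).2.2
    · rw [SimpleGraph.Subgraph.isPerfectMatching_iff]
      exact fun v => ⟨⟨m v.1, (hm v.1 v.2).1⟩, rfl, fun w hw => Subtype.ext (Eq.symm hw)⟩

theorem two_pow_mul_self_add_one_pow_le {k : ℕ} (hk : 0 < k) :
    (2 ^ k * k + 1) ^ (2 * k ^ 2) ≤ 2 ^ (4 * k ^ 3) := by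
  have h1 : k + 1 ≤ 2 ^ k := Nat.lt_two_pow_self
  have h2 : 2 ^ k * k + 1 ≤ 2 ^ (2 * k) := by
    rw [two_mul, pow_add]
    nlinarith [Nat.one_le_two_pow (n := k)]
  calc (2 ^ k * k + 1) ^ (2 * k ^ 2) ≤ (2 ^ (2 * k)) ^ (2 * k ^ 2) := Nat.pow_le_pow_left h2 _
    _ = 2 ^ (4 * k ^ 3) := by rw [← pow_mul]; ring_nf

end

/-- There is an absolute constant `c > 0` such that for every positive integer `k`,
the number of distinct functions `h_{G,k} : 2^{[k]} → {0,1}` (where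
`h_{G,k}(S) = 1` iff `G − S` has a perfect matching), taken over all finite simple
graphs `G` whose vertex set contains `{1,…,k}`, is at most `2^(c·k³)`. -/
theorem count_perfect_matching_deletion_functions :
    ∃ c : ℕ, 0 < c ∧ ∀ k : ℕ, 0 < k →
      {h : Finset (Fin k) → Prop |
          ∃ (n : ℕ) (hkn : k ≤ n) (G : SimpleGraph (Fin n)),
            h = fun S : Finset (Fin k) =>
              HasPerfectMatching
                (G.induce {v : Fin n | v ∉ S.image (Fin.castLE hkn)})}.encard
        ≤ ((2 ^ (c * k ^ 3) : ℕ) : ℕ∞) := by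
  refine ⟨4, by norm_num, fun k hk => ?_⟩
  have : Nonempty (Fin k) := ⟨⟨0, hk⟩⟩
  let M (S : Finset (Fin k)) :
      Matrix (Fin k) (Fin k) (MvPolynomial (Bool × Fin k × Fin k) ℚ) :=
    Matrix.of fun i j => MvPolynomial.X (decide (i ∈ S), i, j)
  have hcard := MvPolynomial.card_zeroPattern_le (fun S => (M S).det) (d := k) fun S => by
    simpa using MvPolynomial.totalDegree_det_le (M S)
      fun i j => (MvPolynomial.totalDegree_X (R := ℚ) _).le
  set P := Set.range fun (x : Bool × Fin k × Fin k → ℚ) (S : Finset (Fin k)) =>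
    MvPolynomial.eval x (M S).det ≠ 0
  have hP : P.encard ≤ ((2 ^ (4 * k ^ 3) : ℕ) : ℕ∞) := by
    rw [← (Set.toFinite P).cast_ncard_eq, Nat.cast_le, ← Nat.card_coe_set_eq]
    refine hcard.trans (le_of_eq_of_le ?_ (two_pow_mul_self_add_one_pow_le hk))
    simp [sq]
  refine le_trans (Set.encard_le_encard ?_) hP
  rintro h ⟨n, hkn, G, rfl⟩
  obtain ⟨A, hA⟩ := G.exists_det_ne_zero_iff_isMatchingOn (F := ℚ)
  obtain ⟨X, Y, hXY⟩ := A.exists_det_ite_ne_zero_iff_det_padPrincipal_ne_zero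
    (Fin.castLEEmb hkn)
  refine ⟨fun p => if p.1 then X p.2.1 p.2.2 else Y p.2.1 p.2.2, funext fun S => ?_⟩
  have hset : {v : Fin n | v ∉ S.image (Fin.castLE hkn)} =
      (((S.map (Fin.castLEEmb hkn))ᶜ : Finset (Fin n)) : Set (Fin n)) := by
    ext v
    simp
  rw [hset, hasPerfectMatching_induce_iff, ← hA, ← hXY]
  beta_reduce
  rw [RingHom.map_det]
  congr! 3
  ext i j
  simp [M]
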